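/- Let R be a pointwise semicommutative semiperiodic ring. If J(R) ≠ N(R), then R is commutative. -/

import Mathlib

/-- A ring `R` is *pointwise semicommutative* if for every `a ∈ R`, either the left
annihilator `l(a)` or the right annihilator `r(a)` is a two-sided ideal of `R`;
equivalently, for every `a`, either (`∀ x r, x*a = 0 → x*r*a = 0`) or
(`∀ x r, a*x = 0 → a*r*x = 0`). -/
def PointwiseSemicommutative (R : Type*) [Ring R] : Prop :=
  ∀ a : R, (∀ x r : R, x * a = 0 → x * r * a = 0) ∨ (∀ x r : R, a * x = 0 → a * r * x = 0)

/-- A ring `R` is *semiperiodic* if for every `w ∈ R` outside `J(R) ∪ C(R)` there exist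
positive integers `p` and `q` of opposite parity with `w ^ q - w ^ p` nilpotent. -/
def Semiperiodic (R : Type*) [Ring R] : Prop :=
  ∀ w : R, w ∉ Ideal.jacobson (⊥ : Ideal R) → ¬(∀ r : R, w * r = r * w) →
    ∃ p q : ℕ, 0 < p ∧ 0 < q ∧ ((Even p ∧ Odd q) ∨ (Odd p ∧ Even q)) ∧
      IsNilpotent (w ^ q - w ^ p)

open Polynomial in
/-- If `w ^ n * (1 - w ^ d) ^ n = 0`, the Fitting decomposition of `w` yields an idempotent
multiple of `w` whose complement makes `w` nilpotent. -/
theorem exists_idempotent_of_pow_mul_one_sub_pow_eq_zero {R : Type*} [Ring R] {w : R} {n d : ℕ}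
    (hn : 0 < n) (hd : 0 < d) (h : w ^ n * (1 - w ^ d) ^ n = 0) :
    ∃ e c : R, e * e = e ∧ c * w = e ∧ Commute e w ∧ IsNilpotent (w * (1 - e)) := by
  set P : ℤ[X] := X ^ n * (1 - X ^ d) ^ n with hP
  set E : ℤ[X] := 1 - (1 - X ^ (d * n)) ^ n with hE
  have hPw : aeval w P = 0 := by simp [hP, h]
  have aeval_eq_zero : ∀ Q : ℤ[X], P ∣ Q → aeval w Q = 0 := by
    rintro Q ⟨C, rfl⟩
    rw [map_mul, hPw, zero_mul]
  have hXE : X ^ (d * n) ∣ E := by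
    have := sub_dvd_pow_sub_pow (1 : ℤ[X]) (1 - X ^ (d * n)) n
    simpa [hE] using this
  have hXnE : X ^ n ∣ E := (pow_dvd_pow X (Nat.le_mul_of_pos_left n hd)).trans hXE
  have hE' : (1 - X ^ d) ^ n ∣ 1 - E := by
    have : (1 - X ^ d : ℤ[X]) ∣ 1 - X ^ (d * n) := by
      simpa [pow_mul] using sub_dvd_pow_sub_pow (1 : ℤ[X]) (X ^ d) n
    simpa [hE] using pow_dvd_pow_of_dvd this n
  obtain ⟨H, hH⟩ : X ∣ E := (dvd_pow_self X hn.ne').trans hXnE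
  refine ⟨aeval w E, aeval w H, ?_, ?_, ?_, n, ?_⟩
  · have := aeval_eq_zero (E * (1 - E)) (mul_dvd_mul hXnE hE')
    rw [mul_sub, mul_one, map_sub, map_mul, sub_eq_zero] at this
    exact this.symm
  · rw [hH, mul_comm X H, map_mul, aeval_X]
  · have := congrArg (aeval w) (mul_comm E X)
    rwa [map_mul, map_mul, aeval_X] at this
  · have := aeval_eq_zero ((X * (1 - E)) ^ n) (by
      rw [mul_pow]
      exact mul_dvd_mul_left _ (hE'.trans (dvd_pow_self _ hn.ne')))
    simpa using this

theorem IsNilpotent.pow_mul_sub_one {R : Type*} [Ring R] {y : R} {d : ℕ}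
    (h : IsNilpotent (y ^ d - 1)) (k : ℕ) : IsNilpotent (y ^ (d * k) - 1) := by
  have hc : Commute (y ^ d) 1 := Commute.one_right _
  rw [pow_mul, ← one_pow (M := R) k, ← hc.mul_geom_sum₂ k]
  refine Commute.isNilpotent_mul_right ?_ h
  refine Commute.sum_right _ _ _ fun i _ ↦ ?_
  simp only [one_pow, mul_one]
  exact ((Commute.refl _).sub_left (Commute.one_left _)).pow_right i

theorem exists_mul_eq_one_of_mem_jacobson {R : Type*} [Ring R] {x : R}
    (hx : x ∈ Ideal.jacobson (⊥ : Ideal R)) : ∃ z, z * (1 + x) = 1 := by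
  obtain ⟨z, hz⟩ := Ideal.mem_jacobson_iff.1 hx 1
  refine ⟨z, ?_⟩
  rw [Ideal.mem_bot, mul_one, sub_eq_zero] at hz
  rw [mul_add, mul_one, add_comm, hz]

theorem exists_mul_add_eq_one_of_mem_jacobson {R : Type*} [Ring R] {x y l : R}
    (hx : x ∈ Ideal.jacobson (⊥ : Ideal R)) (hl : l * y = 1) : ∃ z, z * (y + x) = 1 := by
  obtain ⟨z, hz⟩ := exists_mul_eq_one_of_mem_jacobson (Ideal.mul_mem_left _ l hx)
  exact ⟨z * l, by rw [mul_assoc, mul_add, hl, hz]⟩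

theorem Commute.isNilpotent_of_mul_of_left_inv {R : Type*} [Ring R] {a s t : R}
    (hc : Commute s a) (ht : t * s = 1) (h : IsNilpotent (s * a)) : IsNilpotent a := by
  obtain ⟨k, hk⟩ := h
  refine ⟨k, ?_⟩
  rw [hc.mul_pow] at hk
  have := congrArg (t ^ k * ·) hk
  simpa only [← mul_assoc, pow_mul_pow_eq_one k ht, one_mul, mul_zero] using this

namespace Semiperiodic

variable {R : Type*} [Ring R]

theorem exists_odd (hsp : Semiperiodic R) {w : R}
    (hJ : w ∉ Ideal.jacobson (⊥ : Ideal R)) (hC : ¬ ∀ r : R, w * r = r * w) :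
    ∃ p d : ℕ, 0 < p ∧ Odd d ∧ IsNilpotent (w ^ p * (w ^ d - 1)) := by
  obtain ⟨p, q, hp, hq, hpar, hnil⟩ := hsp w hJ hC
  wlog hpq : p ≤ q generalizing p q
  · refine this q p hq hp (by tauto) ?_ (by omega)
    rw [← neg_sub]
    exact hnil.neg
  refine ⟨p, q - p, hp, by grind, ?_⟩
  rwa [mul_sub, mul_one, ← pow_add, Nat.add_sub_cancel' hpq]

theorem exists_idempotent (hsp : Semiperiodic R) {w : R}
    (hJ : w ∉ Ideal.jacobson (⊥ : Ideal R)) (hC : ¬ ∀ r : R, w * r = r * w) :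
    ∃ e c : R, e * e = e ∧ c * w = e ∧ Commute e w ∧ IsNilpotent (w * (1 - e)) := by
  obtain ⟨p, d, hp, hd, k, hk⟩ := hsp.exists_odd hJ hC
  have hc : Commute (w ^ p) (1 - w ^ d) :=
    (Commute.one_right _).sub_right (Commute.pow_pow_self w p d)
  have hk' : (w ^ p * (1 - w ^ d)) ^ k = 0 := by
    rw [← neg_sub (w ^ d) 1, mul_neg, neg_pow, hk, mul_zero]
  rw [hc.mul_pow, ← pow_mul] at hk'
  refine exists_idempotent_of_pow_mul_one_sub_pow_eq_zero (n := p * k + k + 1) (d := d)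
    (by omega) hd.pos ?_
  have h₁ : p * k + k + 1 = (k + 1) + p * k := by ring
  have h₂ : p * k + k + 1 = k + (p * k + 1) := by ring
  calc w ^ (p * k + k + 1) * (1 - w ^ d) ^ (p * k + k + 1)
      = w ^ (k + 1) * (w ^ (p * k) * (1 - w ^ d) ^ k) * (1 - w ^ d) ^ (p * k + 1) := by
        conv_lhs => rw [h₂, pow_add (1 - w ^ d), ← h₂, h₁, pow_add w]
        noncomm_ring
    _ = 0 := by rw [hk', mul_zero, zero_mul]

theorem exists_odd_pow_sub_one (hsp : Semiperiodic R) {w l : R} (hl : l * w = 1)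
    (hC : ¬ ∀ r : R, w * r = r * w) : ∃ d : ℕ, Odd d ∧ IsNilpotent (w ^ d - 1) := by
  have hJ : w ∉ Ideal.jacobson (⊥ : Ideal R) := by
    intro h
    have h1 : (1 : R) ∈ Ideal.jacobson (⊥ : Ideal R) := hl ▸ Ideal.mul_mem_left _ l h
    obtain ⟨z, hz⟩ := exists_mul_eq_one_of_mem_jacobson (neg_mem h1)
    rw [add_neg_cancel, mul_zero] at hz
    have := subsingleton_of_zero_eq_one hz
    exact hC fun r ↦ Subsingleton.elim _ _
  obtain ⟨p, d, -, hd, h⟩ := hsp.exists_odd hJ hC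
  exact ⟨d, hd, Commute.isNilpotent_of_mul_of_left_inv
    ((Commute.pow_pow_self w p d).sub_right (Commute.one_right _)) (pow_mul_pow_eq_one p hl) h⟩

theorem isNilpotent_two (hsp : Semiperiodic R) {w l : R} (hl : l * w = 1)
    (hC : ¬ ∀ r : R, w * r = r * w) : IsNilpotent (2 : R) := by
  obtain ⟨d, hd, h⟩ := hsp.exists_odd_pow_sub_one hl hC
  obtain ⟨d', hd', h'⟩ := hsp.exists_odd_pow_sub_one (w := -w) (l := -l)
    (by rw [neg_mul_neg, hl]) (by simpa using hC)
  have h₁ := h.pow_mul_sub_one d'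
  have h₂ := h'.pow_mul_sub_one d
  rw [mul_comm d' d, (hd.mul hd').neg_pow] at h₂
  have hc : Commute (w ^ (d * d') - 1) (-w ^ (d * d') - 1) :=
    ((Commute.refl _).neg_right.sub_left (Commute.one_left _)).sub_right (Commute.one_right _)
  have := (hc.isNilpotent_add h₁ h₂).neg
  have h2 : -(w ^ (d * d') - 1 + (-w ^ (d * d') - 1)) = 2 := by
    rw [← one_add_one_eq_two]
    abel
  rwa [h2] at this

end Semiperiodic

/-- Every nilpotent element lies in the Jacobson radical. -/
theorem PointwiseSemicommutative.mem_jacobson_of_isNilpotent {R : Type*} [Ring R]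
    (hR : PointwiseSemicommutative R) (hsp : Semiperiodic R) {a : R} (ha : IsNilpotent a) :
    a ∈ Ideal.jacobson (⊥ : Ideal R) := by
  suffices h : ∀ r : R, ∃ z, z * (1 + r * a) = 1 by
    refine Ideal.mem_jacobson_iff.2 fun r ↦ ?_
    obtain ⟨z, hz⟩ := h r
    refine ⟨z, ?_⟩
    rw [Ideal.mem_bot, sub_eq_zero, ← hz]
    noncomm_ring
  intro r
  by_cases hJ : r * a ∈ Ideal.jacobson (⊥ : Ideal R)
  · exact exists_mul_eq_one_of_mem_jacobson hJ
  suffices h : IsNilpotent (r * a) by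
    obtain ⟨u, hu⟩ := h.isUnit_one_add
    exact ⟨↑u⁻¹, by rw [← hu, Units.inv_mul]⟩
  obtain ⟨n, hn⟩ := ha
  by_cases hC : ∀ s : R, r * a * s = s * (r * a)
  · refine ⟨n, ?_⟩
    have : ∀ k : ℕ, (r * a) ^ k = r ^ k * a ^ k := by
      intro k
      induction k with
      | zero => simp
      | succ k ih =>
        rw [pow_succ, ih, mul_assoc, ← hC, pow_succ, pow_succ' a]
        noncomm_ring
    rw [this, hn, mul_zero]
  obtain ⟨e, c, hee, hce, -, hnil⟩ := hsp.exists_idempotent hJ hC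
  have key : ∀ x y : R, e * x * e * y * e = e * x * y * e := by
    intro x y
    rcases hR e with h | h
    · have := h (1 - e) y (by rw [sub_mul, one_mul, hee, sub_self])
      have hy : e * y * e = y * e := by
        rw [sub_mul, sub_mul, one_mul, sub_eq_zero] at this
        exact this.symm
      rw [mul_assoc (e * x), mul_assoc (e * x), hy, ← mul_assoc]
    · have := h (1 - e) x (by rw [mul_sub, mul_one, hee, sub_self])
      rw [mul_sub, mul_one, sub_eq_zero] at this
      rw [← this]
  have hs : e * (c * r) * e * a * e = e := by
    rw [key, mul_assoc e, mul_assoc c, hce, hee, hee]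
  have hpow : ∀ k : ℕ, ∃ t : R, e * t * e * a ^ k * e = e := by
    intro k
    induction k with
    | zero => exact ⟨1, by simp [hee]⟩
    | succ k ih =>
      obtain ⟨t, ht⟩ := ih
      refine ⟨c * r * e * t, ?_⟩
      calc e * (c * r * e * t) * e * a ^ (k + 1) * e
          = e * (c * r) * e * t * (e * a ^ k * a * e) := by rw [pow_succ]; noncomm_ring
        _ = e * (c * r) * (e * t * e * a ^ k * e) * a * e := by rw [← key]; noncomm_ring
        _ = e := by rw [ht, hs]
  obtain ⟨t, ht⟩ := hpow n
  have he : e = 0 := by rw [← ht, hn, mul_zero, zero_mul]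
  simpa [he] using hnil

/-- If `z ^ D` and `(z + j) ^ D` are both unipotent with `D` odd, `2` and all nilpotents lie in
the Jacobson radical and `j` in the radical commutes with `z`, then `j` is nilpotent. -/
theorem isNilpotent_of_odd_pow_sub_one {R : Type*} [Ring R]
    (hN : ∀ a : R, IsNilpotent a → a ∈ Ideal.jacobson (⊥ : Ideal R)) (h2 : IsNilpotent (2 : R))
    {z j : R} (hj : j ∈ Ideal.jacobson (⊥ : Ideal R)) (hc : Commute z j) {D : ℕ} (hD : Odd D)
    (hz : IsNilpotent (z ^ D - 1)) (hzj : IsNilpotent ((z + j) ^ D - 1)) : IsNilpotent j := by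
  have hc' : Commute (z + j) z := (Commute.refl z).add_left hc.symm
  have hcj : Commute (z + j) j := hc.add_left (Commute.refl j)
  set S := ∑ i ∈ Finset.range D, (z + j) ^ i * z ^ (D - 1 - i) with hS
  have hSj : S * j = (z + j) ^ D - z ^ D := by
    have := hc'.geom_sum₂_mul D
    rwa [add_sub_cancel_left] at this
  have hSjc : Commute S j :=
    Commute.sum_left _ _ _ fun i _ ↦ (hcj.pow_left i).mul_left (hc.pow_left _)
  have hnil : IsNilpotent (S * j) := by
    have hcp : Commute ((z + j) ^ D - 1) (z ^ D - 1) :=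
      ((hc'.pow_pow D D).sub_left (Commute.one_left _)).sub_right (Commute.one_right _)
    have := hcp.isNilpotent_sub hzj hz
    rwa [sub_sub_sub_cancel_right, ← hSj] at this
  have hterm : ∀ i ∈ Finset.range D,
      (z + j) ^ i * z ^ (D - 1 - i) - z ^ (D - 1) ∈ Ideal.jacobson (⊥ : Ideal R) := by
    intro i hi
    have hi' : i + (D - 1 - i) = D - 1 := by
      have := Finset.mem_range.1 hi
      omega
    have h₁ : z ^ (D - 1) = z ^ (D - 1 - i) * z ^ i := by rw [← pow_add, add_comm, hi']
    rw [h₁, (hc'.pow_pow i (D - 1 - i)).eq, ← mul_sub]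
    refine Ideal.mul_mem_left _ _ ?_
    rw [← hc'.geom_sum₂_mul i, add_sub_cancel_left]
    exact Ideal.mul_mem_left _ _ hj
  have hSJ : S - D * z ^ (D - 1) ∈ Ideal.jacobson (⊥ : Ideal R) := by
    have := Ideal.sum_mem _ hterm
    rwa [Finset.sum_sub_distrib, Finset.sum_const, Finset.card_range, nsmul_eq_mul] at this
  have hzS : z * S - 1 ∈ Ideal.jacobson (⊥ : Ideal R) := by
    obtain ⟨k, rfl⟩ := hD
    have e₁ : z * S - 1 = z * (S - ((2 * k + 1 : ℕ) : R) * z ^ (2 * k + 1 - 1)) +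
        (((2 * k + 1 : ℕ) : R) * (z ^ (2 * k + 1) - 1) + (k : R) * 2) := by
      have h₁ : z * (((2 * k + 1 : ℕ) : R) * z ^ (2 * k + 1 - 1)) =
          ((2 * k + 1 : ℕ) : R) * z ^ (2 * k + 1) := by
        rw [← mul_assoc, ← (Nat.cast_commute (2 * k + 1) z).eq, mul_assoc, Nat.add_sub_cancel,
          ← pow_succ']
      rw [mul_sub, h₁, mul_sub, mul_one]
      have h₃ : ((2 * k + 1 : ℕ) : R) = (k : R) * 2 + 1 := by
        push_cast
        rw [(Nat.cast_commute k (2 : R)).eq]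
      rw [h₃]
      abel
    rw [e₁]
    exact add_mem (Ideal.mul_mem_left _ _ hSJ)
      (add_mem (Ideal.mul_mem_left _ _ (hN _ hz)) (Ideal.mul_mem_left _ _ (hN _ h2)))
  obtain ⟨t, ht⟩ := exists_mul_eq_one_of_mem_jacobson hzS
  rw [add_sub_cancel, ← mul_assoc] at ht
  exact Commute.isNilpotent_of_mul_of_left_inv hSjc ht hnil

/-- If all nilpotent elements are central, then so are all idempotents. -/
theorem commute_of_idempotent_of_isNilpotent_central {R : Type*} [Ring R]
    (hN : ∀ a : R, IsNilpotent a → ∀ r : R, a * r = r * a) {e : R} (he : e * e = e) (r : R) :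
    e * r = r * e := by
  have h₁ : e * r - e * r * e = 0 := by
    have hsq : IsNilpotent (e * r - e * r * e) := by
      refine ⟨2, ?_⟩
      calc (e * r - e * r * e) ^ 2 = e * r * (e - e * e) * r * (1 - e) := by noncomm_ring
        _ = 0 := by rw [he]; simp
    have h := hN _ hsq e
    rw [sub_mul, mul_assoc (e * r), he, sub_self, mul_sub] at h
    simpa only [← mul_assoc, he] using h.symm
  have h₂ : r * e - e * r * e = 0 := by
    have hsq : IsNilpotent (r * e - e * r * e) := by
      refine ⟨2, ?_⟩
      calc (r * e - e * r * e) ^ 2 = (1 - e) * r * (e - e * e) * r * e := by noncomm_ring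
        _ = 0 := by rw [he]; simp
    have h := hN _ hsq e
    rw [sub_mul, mul_assoc r, mul_assoc (e * r), he, mul_sub] at h
    simpa only [← mul_assoc, he, sub_self] using h
  rw [sub_eq_zero.1 h₁, sub_eq_zero.1 h₂]

namespace Semiperiodic

variable {R : Type*} [Ring R]

theorem isNilpotent_of_mem_jacobson_of_not_central (hsp : Semiperiodic R)
    (hN : ∀ a : R, IsNilpotent a → a ∈ Ideal.jacobson (⊥ : Ideal R)) {j : R}
    (hj : j ∈ Ideal.jacobson (⊥ : Ideal R)) (hC : ¬ ∀ r : R, j * r = r * j) :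
    IsNilpotent j := by
  obtain ⟨l, hl⟩ := exists_mul_eq_one_of_mem_jacobson hj
  have hC' : ¬ ∀ r : R, (1 + j) * r = r * (1 + j) := by
    simpa only [add_mul, mul_add, one_mul, mul_one, add_right_inj] using hC
  obtain ⟨d, hd, h⟩ := hsp.exists_odd_pow_sub_one hl hC'
  exact isNilpotent_of_odd_pow_sub_one hN (hsp.isNilpotent_two hl hC') hj (Commute.one_left j) hd
    (by simp) h

/-- If the radical is central and contains the nilpotents, a noncentral element can be replaced
by a noncentral left-invertible one. -/
theorem exists_left_inv_not_central (hsp : Semiperiodic R)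
    (hN : ∀ a : R, IsNilpotent a → a ∈ Ideal.jacobson (⊥ : Ideal R))
    (hJC : ∀ j ∈ Ideal.jacobson (⊥ : Ideal R), ∀ r : R, j * r = r * j) {x : R}
    (hx : ¬ ∀ r : R, x * r = r * x) :
    ∃ y l : R, l * y = 1 ∧ ¬ ∀ r : R, y * r = r * y := by
  obtain ⟨e, c, hee, hce, hew, hnil⟩ :=
    hsp.exists_idempotent (fun h ↦ hx (hJC x h)) hx
  have hNC : ∀ a : R, IsNilpotent a → ∀ r : R, a * r = r * a := fun a ha ↦ hJC a (hN a ha)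
  have hec := commute_of_idempotent_of_isNilpotent_central hNC hee
  refine ⟨x * e + (1 - e), c * e + (1 - e), ?_, fun hy ↦ hx fun r ↦ ?_⟩
  · have h₁ : e * (1 - e) = 0 := by rw [mul_sub, mul_one, hee, sub_self]
    have h₂ : (1 - e) * e = 0 := by rw [sub_mul, one_mul, hee, sub_self]
    have h₃ : (1 - e) * (1 - e) = 1 - e := by rw [mul_sub, h₂, mul_one, sub_zero]
    calc (c * e + (1 - e)) * (x * e + (1 - e))
        = c * (e * x) * e + c * (e * (1 - e)) + (1 - e) * (x * e) + (1 - e) * (1 - e) := by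
          noncomm_ring
      _ = 1 := by
        rw [hew.eq, ← mul_assoc c, hce, hee, hee, h₁, ← hew.eq, ← mul_assoc, h₂, h₃]
        simp
  · have h₁ := hy r
    have h₂ := hNC _ hnil r
    have h₃ := hec r
    have e₁ : x = (x * e + (1 - e)) + x * (1 - e) - (1 - e) := by noncomm_ring
    rw [e₁, sub_mul, add_mul, h₁, h₂, sub_mul, h₃]
    noncomm_ring

end Semiperiodic

/-- If a pointwise semicommutative semiperiodic ring satisfies `J(R) ≠ N(R)`, then it is
commutative. -/
theorem commutative_of_pointwiseSemicommutative_semiperiodic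
    (R : Type*) [Ring R] (hR : PointwiseSemicommutative R) (hsp : Semiperiodic R)
    (hne : (Ideal.jacobson (⊥ : Ideal R) : Set R) ≠ {a : R | IsNilpotent a}) :
    ∀ a b : R, a * b = b * a := by
  have hN : ∀ a : R, IsNilpotent a → a ∈ Ideal.jacobson (⊥ : Ideal R) :=
    fun a ha ↦ hR.mem_jacobson_of_isNilpotent hsp ha
  obtain ⟨j, hj, hjN⟩ : ∃ j ∈ Ideal.jacobson (⊥ : Ideal R), ¬ IsNilpotent j := by
    by_contra! h
    exact hne (Set.Subset.antisymm h hN)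
  have hjC : ∀ r : R, j * r = r * j := by
    by_contra hC
    exact hjN (hsp.isNilpotent_of_mem_jacobson_of_not_central hN hj hC)
  have hJC : ∀ k ∈ Ideal.jacobson (⊥ : Ideal R), ∀ r : R, k * r = r * k := by
    intro k hk
    by_contra hC
    have hkN := hsp.isNilpotent_of_mem_jacobson_of_not_central hN hk hC
    have hjk := hsp.isNilpotent_of_mem_jacobson_of_not_central hN (add_mem hj hk)
      (by simpa only [add_mul, mul_add, hjC, add_right_inj] using hC)
    have hc : Commute (j + k) k := Commute.add_left (hjC k) (Commute.refl k)
    exact hjN (by simpa using hc.isNilpotent_sub hjk hkN)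
  intro x
  by_contra hx
  obtain ⟨y, l, hl, hy⟩ := hsp.exists_left_inv_not_central hN hJC hx
  obtain ⟨l', hl'⟩ := exists_mul_add_eq_one_of_mem_jacobson hj hl
  have hyj : ¬ ∀ r : R, (y + j) * r = r * (y + j) := by
    simpa only [add_mul, mul_add, hjC, add_left_inj] using hy
  obtain ⟨d, hd, h⟩ := hsp.exists_odd_pow_sub_one hl hy
  obtain ⟨d', hd', h'⟩ := hsp.exists_odd_pow_sub_one hl' hyj
  refine hjN (isNilpotent_of_odd_pow_sub_one hN (hsp.isNilpotent_two hl hy) hj (hjC y).symm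
    (hd.mul hd') (h.pow_mul_sub_one d') ?_)
  rw [mul_comm d d']
  exact h'.pow_mul_sub_one d
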